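/- Erasure version of the three-user layer-splitting lemma: Let p(a₁|a) and p(b₁|b) be erasure channels with erasure probabilities α and β respectively (the erasure events independent of everything else). Then 𝓡_MAC(A,B,C;Y) = ⋃_{α∈[0,1]} ⋃_{β∈[0,1]} ⋃_{λ=1}^{3} 𝓡(α,β,λ). In particular, 𝓡(α,β,1) covers the triangle of the dominant face with vertices I_ACB, I_ABC, I_BAC; 𝓡(α,β,2) covers the triangle with vertices I_BCA, I_CBA, I_CAB; and 𝓡(α,β,3) covers the trapezoid with vertices I_ACB, I_BAC, I_BCA, I_CAB. -/

import Mathlib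

open scoped BigOperators Classical

noncomputable section

/-- Pushforward of a finitely supported weight function along a map. -/
def pushf {Ω β : Type*} [Fintype Ω] (q : Ω → ℝ) (f : Ω → β) : β → ℝ :=
  fun b => ∑ ω, if f ω = b then q ω else 0

/-- Shannon entropy (in nats). -/
def ent {β : Type*} [Fintype β] (p : β → ℝ) : ℝ :=
  -∑ b, p b * Real.log (p b)

/-- Entropy of the random variable `A` under the joint pmf `q`. -/
def Hof {Ω β : Type*} [Fintype Ω] [Fintype β] (q : Ω → ℝ) (A : Ω → β) : ℝ :=
  ent (pushf q A)

/-- Mutual information `I(A;B)` under the joint pmf `q`. -/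
def miOf {Ω α β : Type*} [Fintype Ω] [Fintype α] [Fintype β]
    (q : Ω → ℝ) (A : Ω → α) (B : Ω → β) : ℝ :=
  Hof q A + Hof q B - Hof q (fun ω => (A ω, B ω))

/-- Conditional mutual information `I(A;B|C)` under the joint pmf `q`. -/
def cmiOf {Ω α β γ : Type*} [Fintype Ω] [Fintype α] [Fintype β] [Fintype γ]
    (q : Ω → ℝ) (A : Ω → α) (B : Ω → β) (C : Ω → γ) : ℝ :=
  Hof q (fun ω => (A ω, C ω)) + Hof q (fun ω => (B ω, C ω))
    - Hof q (fun ω => (A ω, B ω, C ω)) - Hof q C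

/-- `p` is a probability mass function. -/
def IsPMF {α : Type*} [Fintype α] (p : α → ℝ) : Prop :=
  (∀ a, 0 ≤ p a) ∧ ∑ a, p a = 1

/-- Joint pmf on `(A, B, C, Y)` for a three-user MAC with independent inputs. -/
def macJoint {𝒜 ℬ 𝒞 𝒴 : Type} (pA : 𝒜 → ℝ) (pB : ℬ → ℝ) (pC : 𝒞 → ℝ)
    (ch : 𝒜 → ℬ → 𝒞 → 𝒴 → ℝ) : 𝒜 × ℬ × 𝒞 × 𝒴 → ℝ :=
  fun ω => pA ω.1 * pB ω.2.1 * pC ω.2.2.1 * ch ω.1 ω.2.1 ω.2.2.1 ω.2.2.2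

/-- The standard three-user MAC region `𝓡_MAC(A,B,C;Y)` (seven inequalities). -/
def RMAC {𝒜 ℬ 𝒞 𝒴 : Type} [Fintype 𝒜] [Fintype ℬ] [Fintype 𝒞] [Fintype 𝒴]
    (pA : 𝒜 → ℝ) (pB : ℬ → ℝ) (pC : 𝒞 → ℝ)
    (ch : 𝒜 → ℬ → 𝒞 → 𝒴 → ℝ) : Set (ℝ × ℝ × ℝ) :=
  {r | 0 ≤ r.1 ∧ 0 ≤ r.2.1 ∧ 0 ≤ r.2.2 ∧
    r.1 ≤ cmiOf (macJoint pA pB pC ch) (fun ω => ω.1) (fun ω => ω.2.2.2)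
      (fun ω => (ω.2.1, ω.2.2.1)) ∧
    r.2.1 ≤ cmiOf (macJoint pA pB pC ch) (fun ω => ω.2.1) (fun ω => ω.2.2.2)
      (fun ω => (ω.1, ω.2.2.1)) ∧
    r.2.2 ≤ cmiOf (macJoint pA pB pC ch) (fun ω => ω.2.2.1) (fun ω => ω.2.2.2)
      (fun ω => (ω.1, ω.2.1)) ∧
    r.1 + r.2.1 ≤ cmiOf (macJoint pA pB pC ch) (fun ω => (ω.1, ω.2.1)) (fun ω => ω.2.2.2)
      (fun ω => ω.2.2.1) ∧
    r.1 + r.2.2 ≤ cmiOf (macJoint pA pB pC ch) (fun ω => (ω.1, ω.2.2.1)) (fun ω => ω.2.2.2)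
      (fun ω => ω.2.1) ∧
    r.2.1 + r.2.2 ≤ cmiOf (macJoint pA pB pC ch) (fun ω => (ω.2.1, ω.2.2.1))
      (fun ω => ω.2.2.2) (fun ω => ω.1) ∧
    r.1 + r.2.1 + r.2.2 ≤ miOf (macJoint pA pB pC ch) (fun ω => (ω.1, ω.2.1, ω.2.2.1))
      (fun ω => ω.2.2.2)}

variable {𝒜 ℬ 𝒞 𝒴 : Type} [Fintype 𝒜] [Fintype ℬ] [Fintype 𝒞] [Fintype 𝒴]

/-- Corner point `I_ABC = (I(A;Y), I(B;Y|A), I(C;Y|A,B))` of the dominant face. -/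
def vABC (pA : 𝒜 → ℝ) (pB : ℬ → ℝ) (pC : 𝒞 → ℝ) (ch : 𝒜 → ℬ → 𝒞 → 𝒴 → ℝ) : ℝ × ℝ × ℝ :=
  (miOf (macJoint pA pB pC ch) (fun ω => ω.1) (fun ω => ω.2.2.2),
   cmiOf (macJoint pA pB pC ch) (fun ω => ω.2.1) (fun ω => ω.2.2.2) (fun ω => ω.1),
   cmiOf (macJoint pA pB pC ch) (fun ω => ω.2.2.1) (fun ω => ω.2.2.2) (fun ω => (ω.1, ω.2.1)))

/-- Corner point `I_BAC = (I(A;Y|B), I(B;Y), I(C;Y|B,A))`. -/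
def vBAC (pA : 𝒜 → ℝ) (pB : ℬ → ℝ) (pC : 𝒞 → ℝ) (ch : 𝒜 → ℬ → 𝒞 → 𝒴 → ℝ) : ℝ × ℝ × ℝ :=
  (cmiOf (macJoint pA pB pC ch) (fun ω => ω.1) (fun ω => ω.2.2.2) (fun ω => ω.2.1),
   miOf (macJoint pA pB pC ch) (fun ω => ω.2.1) (fun ω => ω.2.2.2),
   cmiOf (macJoint pA pB pC ch) (fun ω => ω.2.2.1) (fun ω => ω.2.2.2) (fun ω => (ω.2.1, ω.1)))

/-- Corner point `I_BCA = (I(A;Y|B,C), I(B;Y), I(C;Y|B))`. -/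
def vBCA (pA : 𝒜 → ℝ) (pB : ℬ → ℝ) (pC : 𝒞 → ℝ) (ch : 𝒜 → ℬ → 𝒞 → 𝒴 → ℝ) : ℝ × ℝ × ℝ :=
  (cmiOf (macJoint pA pB pC ch) (fun ω => ω.1) (fun ω => ω.2.2.2) (fun ω => (ω.2.1, ω.2.2.1)),
   miOf (macJoint pA pB pC ch) (fun ω => ω.2.1) (fun ω => ω.2.2.2),
   cmiOf (macJoint pA pB pC ch) (fun ω => ω.2.2.1) (fun ω => ω.2.2.2) (fun ω => ω.2.1))

/-- Corner point `I_CBA = (I(A;Y|C,B), I(B;Y|C), I(C;Y))`. -/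
def vCBA (pA : 𝒜 → ℝ) (pB : ℬ → ℝ) (pC : 𝒞 → ℝ) (ch : 𝒜 → ℬ → 𝒞 → 𝒴 → ℝ) : ℝ × ℝ × ℝ :=
  (cmiOf (macJoint pA pB pC ch) (fun ω => ω.1) (fun ω => ω.2.2.2) (fun ω => (ω.2.2.1, ω.2.1)),
   cmiOf (macJoint pA pB pC ch) (fun ω => ω.2.1) (fun ω => ω.2.2.2) (fun ω => ω.2.2.1),
   miOf (macJoint pA pB pC ch) (fun ω => ω.2.2.1) (fun ω => ω.2.2.2))

/-- Corner point `I_CAB = (I(A;Y|C), I(B;Y|C,A), I(C;Y))`. -/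
def vCAB (pA : 𝒜 → ℝ) (pB : ℬ → ℝ) (pC : 𝒞 → ℝ) (ch : 𝒜 → ℬ → 𝒞 → 𝒴 → ℝ) : ℝ × ℝ × ℝ :=
  (cmiOf (macJoint pA pB pC ch) (fun ω => ω.1) (fun ω => ω.2.2.2) (fun ω => ω.2.2.1),
   cmiOf (macJoint pA pB pC ch) (fun ω => ω.2.1) (fun ω => ω.2.2.2) (fun ω => (ω.2.2.1, ω.1)),
   miOf (macJoint pA pB pC ch) (fun ω => ω.2.2.1) (fun ω => ω.2.2.2))

/-- Corner point `I_ACB = (I(A;Y), I(B;Y|A,C), I(C;Y|A))`. -/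
def vACB (pA : 𝒜 → ℝ) (pB : ℬ → ℝ) (pC : 𝒞 → ℝ) (ch : 𝒜 → ℬ → 𝒞 → 𝒴 → ℝ) : ℝ × ℝ × ℝ :=
  (miOf (macJoint pA pB pC ch) (fun ω => ω.1) (fun ω => ω.2.2.2),
   cmiOf (macJoint pA pB pC ch) (fun ω => ω.2.1) (fun ω => ω.2.2.2) (fun ω => (ω.1, ω.2.2.1)),
   cmiOf (macJoint pA pB pC ch) (fun ω => ω.2.2.1) (fun ω => ω.2.2.2) (fun ω => ω.1))

/-- `𝓡(α,β,1)` under erasure splits. -/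
def RegE1 (pA : 𝒜 → ℝ) (pB : ℬ → ℝ) (pC : 𝒞 → ℝ) (ch : 𝒜 → ℬ → 𝒞 → 𝒴 → ℝ)
    (α β : ℝ) : Set (ℝ × ℝ × ℝ) :=
  {r | 0 ≤ r ∧ r ≤ ((1 - α) * (1 - β)) • vABC pA pB pC ch
      + (α * (1 - β)) • vBAC pA pB pC ch + β • vACB pA pB pC ch}

/-- `𝓡(α,β,2)` under erasure splits. -/
def RegE2 (pA : 𝒜 → ℝ) (pB : ℬ → ℝ) (pC : 𝒞 → ℝ) (ch : 𝒜 → ℬ → 𝒞 → 𝒴 → ℝ)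
    (α β : ℝ) : Set (ℝ × ℝ × ℝ) :=
  {r | 0 ≤ r ∧ r ≤ ((1 - α) * β) • vCAB pA pB pC ch
      + (α * β) • vCBA pA pB pC ch + (1 - β) • vBCA pA pB pC ch}

/-- `𝓡(α,β,3)` under erasure splits. -/
def RegE3 (pA : 𝒜 → ℝ) (pB : ℬ → ℝ) (pC : 𝒞 → ℝ) (ch : 𝒜 → ℬ → 𝒞 → 𝒴 → ℝ)
    (α β : ℝ) : Set (ℝ × ℝ × ℝ) :=
  {r | 0 ≤ r ∧ r ≤ ((1 - α) * (1 - β)) • vBAC pA pB pC ch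
      + ((1 - α) * β) • vACB pA pB pC ch + (α * (1 - β)) • vBCA pA pB pC ch
      + (α * β) • vCAB pA pB pC ch}

/-! ### Shannon inequalities for finite weight functions -/

section Entropy

variable {Ω β₁ β₂ β₃ : Type*} [Fintype Ω]

theorem sum_pushf_mul [Fintype β₁] (q : Ω → ℝ) (X : Ω → β₁) (g : β₁ → ℝ) :
    ∑ x, pushf q X x * g x = ∑ ω, q ω * g (X ω) := by
  simp only [pushf, Finset.sum_mul, ite_mul, zero_mul]
  rw [Finset.sum_comm]
  simp

theorem sum_pushf [Fintype β₁] (q : Ω → ℝ) (X : Ω → β₁) : ∑ x, pushf q X x = ∑ ω, q ω := by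
  simpa using sum_pushf_mul q X (fun _ => 1)

theorem sum_pushf_pair [Fintype β₁] (q : Ω → ℝ) (X : Ω → β₁) (Z : Ω → β₂) (z : β₂) :
    ∑ x, pushf q (fun ω => (X ω, Z ω)) (x, z) = pushf q Z z := by
  simp only [pushf, Prod.mk.injEq, ite_and]
  rw [Finset.sum_comm]
  simp

theorem pushf_nonneg {q : Ω → ℝ} (hq : ∀ ω, 0 ≤ q ω) (X : Ω → β₁) (x : β₁) :
    0 ≤ pushf q X x :=
  Finset.sum_nonneg fun ω _ => by split_ifs <;> simp [hq]

theorem pushf_pos {q : Ω → ℝ} (hq : ∀ ω, 0 ≤ q ω) (X : Ω → β₁) {ω : Ω} (hω : 0 < q ω) :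
    0 < pushf q X (X ω) := by
  refine Finset.sum_pos' (fun ω _ => ?_) ⟨ω, Finset.mem_univ _, by simpa using hω⟩
  split_ifs <;> simp [hq]

theorem Hof_eq_sum [Fintype β₁] (q : Ω → ℝ) (X : Ω → β₁) :
    Hof q X = -∑ ω, q ω * Real.log (pushf q X (X ω)) := by
  rw [Hof, ent, sum_pushf_mul q X (fun x => Real.log (pushf q X x))]

theorem Hof_congr [Fintype β₁] [Fintype β₂] (q : Ω → ℝ) {X : Ω → β₁} {Z : Ω → β₂}
    (h : ∀ ω ω', X ω = X ω' ↔ Z ω = Z ω') : Hof q X = Hof q Z := by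
  simp only [Hof_eq_sum, pushf, h]

theorem Hof_const {q : Ω → ℝ} (hq : ∑ ω, q ω = 1) : Hof q (fun _ => ()) = 0 := by
  simp [Hof_eq_sum, pushf, hq]

theorem sum_pushf_mul_div_le [Fintype β₁] [Fintype β₂] [Fintype β₃] {q : Ω → ℝ}
    (hq : ∀ ω, 0 ≤ q ω) (X : Ω → β₁) (W : Ω → β₂) (Z : Ω → β₃) :
    ∑ ω, q ω * (pushf q (fun ω => (X ω, Z ω)) (X ω, Z ω)
        * pushf q (fun ω => (W ω, Z ω)) (W ω, Z ω)
        / (pushf q (fun ω => (X ω, W ω, Z ω)) (X ω, W ω, Z ω) * pushf q Z (Z ω)))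
      ≤ ∑ ω, q ω := by
  have key := sum_pushf_mul q (fun ω => (X ω, W ω, Z ω)) (fun t =>
    pushf q (fun ω => (X ω, Z ω)) (t.1, t.2.2) * pushf q (fun ω => (W ω, Z ω)) t.2
      / (pushf q (fun ω => (X ω, W ω, Z ω)) t * pushf q Z t.2.2))
  simp only at key
  rw [← key]
  calc _ ≤ ∑ t : β₁ × β₂ × β₃, pushf q (fun ω => (X ω, Z ω)) (t.1, t.2.2)
          * pushf q (fun ω => (W ω, Z ω)) t.2 / pushf q Z t.2.2 := by
        refine Finset.sum_le_sum fun t _ => ?_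
        have h1 := pushf_nonneg hq (fun ω => (X ω, Z ω)) (t.1, t.2.2)
        have h2 := pushf_nonneg hq (fun ω => (W ω, Z ω)) t.2
        have h3 := pushf_nonneg hq Z t.2.2
        rcases eq_or_ne (pushf q (fun ω => (X ω, W ω, Z ω)) t) 0 with h | h
        · rw [h]
          simp only [zero_mul]
          positivity
        · rw [← mul_div_assoc, mul_div_mul_left _ _ h]
    _ = ∑ z, pushf q Z z * pushf q Z z / pushf q Z z := by
        rw [Fintype.sum_prod_type]
        simp only [Fintype.sum_prod_type_right]
        rw [Finset.sum_comm]
        refine Finset.sum_congr rfl fun z _ => ?_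
        simp only [← Finset.sum_div, ← Finset.mul_sum, ← Finset.sum_mul, sum_pushf_pair]
    _ = ∑ ω, q ω := by
        simp only [mul_self_div_self, sum_pushf]

theorem cmiOf_nonneg [Fintype β₁] [Fintype β₂] [Fintype β₃] {q : Ω → ℝ}
    (hq : ∀ ω, 0 ≤ q ω) (X : Ω → β₁) (W : Ω → β₂) (Z : Ω → β₃) :
    0 ≤ cmiOf q X W Z := by
  have h := sum_pushf_mul_div_le hq X W Z
  have hle : ∑ ω, q ω * (1 - pushf q (fun ω => (X ω, Z ω)) (X ω, Z ω)
        * pushf q (fun ω => (W ω, Z ω)) (W ω, Z ω)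
        / (pushf q (fun ω => (X ω, W ω, Z ω)) (X ω, W ω, Z ω) * pushf q Z (Z ω)))
      ≤ ∑ ω, q ω * (Real.log (pushf q (fun ω => (X ω, W ω, Z ω)) (X ω, W ω, Z ω))
        + Real.log (pushf q Z (Z ω)) - Real.log (pushf q (fun ω => (X ω, Z ω)) (X ω, Z ω))
        - Real.log (pushf q (fun ω => (W ω, Z ω)) (W ω, Z ω))) := by
    refine Finset.sum_le_sum fun ω _ => ?_
    rcases (hq ω).eq_or_lt with h0 | h0
    · simp [← h0]
    · have h1 := pushf_pos hq (fun ω => (X ω, Z ω)) h0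
      have h2 := pushf_pos hq (fun ω => (W ω, Z ω)) h0
      have h3 := pushf_pos hq (fun ω => (X ω, W ω, Z ω)) h0
      have h4 := pushf_pos hq Z h0
      refine mul_le_mul_of_nonneg_left ?_ h0.le
      have hlog := Real.log_le_sub_one_of_pos (div_pos (mul_pos h1 h2) (mul_pos h3 h4))
      rw [Real.log_div (mul_pos h1 h2).ne' (mul_pos h3 h4).ne', Real.log_mul h1.ne' h2.ne',
        Real.log_mul h3.ne' h4.ne'] at hlog
      linarith
  simp only [mul_sub, mul_add, Finset.sum_sub_distrib, Finset.sum_add_distrib, mul_one] at hle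
  simp only [cmiOf, Hof_eq_sum]
  linarith

theorem Hof_pair_le [Fintype β₁] [Fintype β₂] {q : Ω → ℝ} (hq : IsPMF q) (X : Ω → β₁)
    (W : Ω → β₂) :
    Hof q (fun ω => (X ω, W ω)) ≤ Hof q X + Hof q W := by
  have h := cmiOf_nonneg hq.1 X W (fun _ => ())
  have hX : Hof q (fun ω => (X ω, ())) = Hof q X := Hof_congr q (by simp)
  have hW : Hof q (fun ω => (W ω, ())) = Hof q W := Hof_congr q (by simp)
  have hXW : Hof q (fun ω => (X ω, W ω, ())) = Hof q (fun ω => (X ω, W ω)) :=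
    Hof_congr q (by simp)
  rw [cmiOf, hX, hW, hXW, Hof_const hq.2] at h
  linarith

end Entropy

/-! ### Independence of the inputs -/

section Inputs

variable {pA : 𝒜 → ℝ} {pB : ℬ → ℝ} {pC : 𝒞 → ℝ} {ch : 𝒜 → ℬ → 𝒞 → 𝒴 → ℝ}

theorem sum_macJoint_mul (hch1 : ∀ a b c, ∑ y, ch a b c y = 1) (g : 𝒜 → ℬ → 𝒞 → ℝ) :
    ∑ ω, macJoint pA pB pC ch ω * g ω.1 ω.2.1 ω.2.2.1
      = ∑ a, ∑ b, ∑ c, pA a * pB b * pC c * g a b c := by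
  simp only [Fintype.sum_prod_type, macJoint]
  refine Finset.sum_congr rfl fun a _ => Finset.sum_congr rfl fun b _ =>
    Finset.sum_congr rfl fun c _ => ?_
  rw [← Finset.sum_mul, ← Finset.mul_sum, hch1, mul_one]

theorem isPMF_macJoint (hpA : IsPMF pA) (hpB : IsPMF pB) (hpC : IsPMF pC)
    (hch0 : ∀ a b c y, 0 ≤ ch a b c y) (hch1 : ∀ a b c, ∑ y, ch a b c y = 1) :
    IsPMF (macJoint pA pB pC ch) := by
  refine ⟨fun ω => mul_nonneg (mul_nonneg (mul_nonneg (hpA.1 _) (hpB.1 _)) (hpC.1 _))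
    (hch0 _ _ _ _), ?_⟩
  have h := sum_macJoint_mul (pA := pA) (pB := pB) (pC := pC) hch1 (fun _ _ _ => 1)
  simpa [← Finset.mul_sum, hpA.2, hpB.2, hpC.2] using h

theorem pushf_macJoint (hch1 : ∀ a b c, ∑ y, ch a b c y = 1) {δ : Type*}
    (g : 𝒜 → ℬ → 𝒞 → δ) (d : δ) :
    pushf (macJoint pA pB pC ch) (fun ω => g ω.1 ω.2.1 ω.2.2.1) d
      = ∑ a, ∑ b, ∑ c, pA a * pB b * pC c * if g a b c = d then 1 else 0 := by
  rw [← sum_macJoint_mul hch1 (fun a b c => if g a b c = d then 1 else 0)]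
  simp [pushf]

theorem Hof_inputs (hpA : IsPMF pA) (hpB : IsPMF pB) (hpC : IsPMF pC)
    (hch1 : ∀ a b c, ∑ y, ch a b c y = 1) :
    Hof (macJoint pA pB pC ch) (fun ω => (ω.1, ω.2.1, ω.2.2.1))
      = Hof (macJoint pA pB pC ch) (fun ω => ω.1) + Hof (macJoint pA pB pC ch) (fun ω => ω.2.1)
        + Hof (macJoint pA pB pC ch) (fun ω => ω.2.2.1) := by
  have hA (a : 𝒜) : pushf (macJoint pA pB pC ch) (fun ω => ω.1) a = pA a := by
    rw [pushf_macJoint hch1 (fun a _ _ => a)]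
    simp [← Finset.mul_sum, hpB.2, hpC.2]
  have hB (b : ℬ) : pushf (macJoint pA pB pC ch) (fun ω => ω.2.1) b = pB b := by
    rw [pushf_macJoint hch1 (fun _ b _ => b)]
    simp [← Finset.mul_sum, ← Finset.sum_mul, hpA.2, hpC.2]
  have hC (c : 𝒞) : pushf (macJoint pA pB pC ch) (fun ω => ω.2.2.1) c = pC c := by
    rw [pushf_macJoint hch1 (fun _ _ c => c)]
    simp [← Finset.mul_sum, ← Finset.sum_mul, hpA.2, hpB.2]
  have hABC (t : 𝒜 × ℬ × 𝒞) :
      pushf (macJoint pA pB pC ch) (fun ω => (ω.1, ω.2.1, ω.2.2.1)) t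
        = pA t.1 * pB t.2.1 * pC t.2.2 := by
    rw [pushf_macJoint hch1 (fun a b c => (a, b, c))]
    obtain ⟨a, b, c⟩ := t
    simp [ite_and]
  simp only [Hof_eq_sum, hA, hB, hC, hABC, ← neg_add, ← Finset.sum_add_distrib, ← mul_add]
  congr 1
  refine Finset.sum_congr rfl fun ω _ => ?_
  by_cases h : macJoint pA pB pC ch ω = 0
  · simp [h]
  · have h' := h
    simp only [macJoint, mul_eq_zero, not_or] at h'
    rw [Real.log_mul (mul_ne_zero h'.1.1.1 h'.1.1.2) h'.1.2, Real.log_mul h'.1.1.1 h'.1.1.2]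

end Inputs

/-! ### Polymatroids on three elements -/

/-- The values of a polymatroid rank function on the nonempty subsets of a three-element set. -/
structure Polymatroid3 where
  (a b c ab ac bc abc : ℝ)
  a_nonneg : 0 ≤ a
  b_nonneg : 0 ≤ b
  c_nonneg : 0 ≤ c
  ab_le_abc : ab ≤ abc
  ac_le_abc : ac ≤ abc
  bc_le_abc : bc ≤ abc
  a_le_ab : a ≤ ab
  b_le_ab : b ≤ ab
  a_le_ac : a ≤ ac
  c_le_ac : c ≤ ac
  b_le_bc : b ≤ bc
  c_le_bc : c ≤ bc
  ab_le : ab ≤ a + b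
  ac_le : ac ≤ a + c
  bc_le : bc ≤ b + c
  abc_add_a_le : abc + a ≤ ab + ac
  abc_add_b_le : abc + b ≤ ab + bc
  abc_add_c_le : abc + c ≤ ac + bc

namespace Polymatroid3

/-- The independence polytope. -/
def region (F : Polymatroid3) : Set (ℝ × ℝ × ℝ) :=
  {r | 0 ≤ r.1 ∧ 0 ≤ r.2.1 ∧ 0 ≤ r.2.2 ∧ r.1 ≤ F.a ∧ r.2.1 ≤ F.b ∧ r.2.2 ≤ F.c ∧
    r.1 + r.2.1 ≤ F.ab ∧ r.1 + r.2.2 ≤ F.ac ∧ r.2.1 + r.2.2 ≤ F.bc ∧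
    r.1 + r.2.1 + r.2.2 ≤ F.abc}

/-- Exchange of the first and the third element. -/
def swap (F : Polymatroid3) : Polymatroid3 where
  a := F.c
  b := F.b
  c := F.a
  ab := F.bc
  ac := F.ac
  bc := F.ab
  abc := F.abc
  a_nonneg := F.c_nonneg
  b_nonneg := F.b_nonneg
  c_nonneg := F.a_nonneg
  ab_le_abc := F.bc_le_abc
  ac_le_abc := F.ac_le_abc
  bc_le_abc := F.ab_le_abc
  a_le_ab := F.c_le_bc
  b_le_ab := F.b_le_bc
  a_le_ac := F.c_le_ac
  c_le_ac := F.a_le_ac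
  b_le_bc := F.b_le_ab
  c_le_bc := F.a_le_ab
  ab_le := by linarith [F.bc_le]
  ac_le := by linarith [F.ac_le]
  bc_le := by linarith [F.ab_le]
  abc_add_a_le := by linarith [F.abc_add_c_le]
  abc_add_b_le := by linarith [F.abc_add_b_le]
  abc_add_c_le := by linarith [F.abc_add_a_le]

/-- The vertex of the dominant face for the decoding order `ABC`. -/
def vABC (F : Polymatroid3) : ℝ × ℝ × ℝ := (F.abc - F.bc, F.bc - F.c, F.c)

/-- The vertex of the dominant face for the decoding order `ACB`. -/
def vACB (F : Polymatroid3) : ℝ × ℝ × ℝ := (F.abc - F.bc, F.b, F.bc - F.b)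

/-- The vertex of the dominant face for the decoding order `BAC`. -/
def vBAC (F : Polymatroid3) : ℝ × ℝ × ℝ := (F.ac - F.c, F.abc - F.ac, F.c)

/-- The vertex of the dominant face for the decoding order `BCA`. -/
def vBCA (F : Polymatroid3) : ℝ × ℝ × ℝ := (F.a, F.abc - F.ac, F.ac - F.a)

/-- The vertex of the dominant face for the decoding order `CBA`. -/
def vCBA (F : Polymatroid3) : ℝ × ℝ × ℝ := (F.a, F.ab - F.a, F.abc - F.ab)

/-- The vertex of the dominant face for the decoding order `CAB`. -/
def vCAB (F : Polymatroid3) : ℝ × ℝ × ℝ := (F.ab - F.b, F.b, F.abc - F.ab)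

variable (F : Polymatroid3)

theorem convex_region : Convex ℝ F.region := by
  have h1 : IsLinearMap ℝ (fun r : ℝ × ℝ × ℝ => r.1) := ⟨by simp, by simp⟩
  have h2 : IsLinearMap ℝ (fun r : ℝ × ℝ × ℝ => r.2.1) := ⟨by simp, by simp⟩
  have h3 : IsLinearMap ℝ (fun r : ℝ × ℝ × ℝ => r.2.2) := ⟨by simp, by simp⟩
  have add {f g : ℝ × ℝ × ℝ → ℝ} (hf : IsLinearMap ℝ f) (hg : IsLinearMap ℝ g) :
      IsLinearMap ℝ (fun r => f r + g r) :=
    ⟨fun x y => by rw [hf.map_add, hg.map_add, add_add_add_comm],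
      fun t x => by rw [hf.map_smul, hg.map_smul, smul_add]⟩
  exact (convex_halfSpace_ge h1 _).inter <| (convex_halfSpace_ge h2 _).inter <|
    (convex_halfSpace_ge h3 _).inter <| (convex_halfSpace_le h1 _).inter <|
    (convex_halfSpace_le h2 _).inter <| (convex_halfSpace_le h3 _).inter <|
    (convex_halfSpace_le (add h1 h2) _).inter <| (convex_halfSpace_le (add h1 h3) _).inter <|
    (convex_halfSpace_le (add h2 h3) _).inter <| convex_halfSpace_le (add (add h1 h2) h3) _

theorem mem_region_of_le {r s : ℝ × ℝ × ℝ} (hr : 0 ≤ r) (hrs : r ≤ s) (hs : s ∈ F.region) :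
    r ∈ F.region := by
  simp only [Prod.le_def, Prod.fst_zero, Prod.snd_zero] at hr hrs
  simp only [region, Set.mem_ofPred_eq] at hs ⊢
  refine ⟨?_, ?_, ?_, ?_, ?_, ?_, ?_, ?_, ?_, ?_⟩ <;> linarith

theorem vABC_mem : F.vABC ∈ F.region := by
  cases F
  simp only [region, vABC, Set.mem_ofPred_eq]
  refine ⟨?_, ?_, ?_, ?_, ?_, ?_, ?_, ?_, ?_, ?_⟩ <;> linarith

theorem vACB_mem : F.vACB ∈ F.region := by
  cases F
  simp only [region, vACB, Set.mem_ofPred_eq]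
  refine ⟨?_, ?_, ?_, ?_, ?_, ?_, ?_, ?_, ?_, ?_⟩ <;> linarith

theorem vBAC_mem : F.vBAC ∈ F.region := by
  cases F
  simp only [region, vBAC, Set.mem_ofPred_eq]
  refine ⟨?_, ?_, ?_, ?_, ?_, ?_, ?_, ?_, ?_, ?_⟩ <;> linarith

theorem vBCA_mem : F.vBCA ∈ F.region := by
  cases F
  simp only [region, vBCA, Set.mem_ofPred_eq]
  refine ⟨?_, ?_, ?_, ?_, ?_, ?_, ?_, ?_, ?_, ?_⟩ <;> linarith

theorem vCBA_mem : F.vCBA ∈ F.region := by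
  cases F
  simp only [region, vCBA, Set.mem_ofPred_eq]
  refine ⟨?_, ?_, ?_, ?_, ?_, ?_, ?_, ?_, ?_, ?_⟩ <;> linarith

theorem vCAB_mem : F.vCAB ∈ F.region := by
  cases F
  simp only [region, vCAB, Set.mem_ofPred_eq]
  refine ⟨?_, ?_, ?_, ?_, ?_, ?_, ?_, ?_, ?_, ?_⟩ <;> linarith

/-- Every point of the polytope is dominated by a point of the dominant face. -/
theorem exists_dominating {r : ℝ × ℝ × ℝ} (hr : r ∈ F.region) :
    ∃ s ∈ F.region, r ≤ s ∧ s.1 + s.2.1 + s.2.2 = F.abc := by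
  obtain ⟨x, y, z⟩ := r
  have raise (p q r s l : ℝ) (hp : l ≤ p) (hq : l ≤ q) (hr : l ≤ r) (hs : l ≤ s) :
      ∃ m, l ≤ m ∧ m ≤ p ∧ m ≤ q ∧ m ≤ r ∧ m ≤ s ∧ (m = p ∨ m = q ∨ m = r ∨ m = s) := by
    rcases le_total p q with h1 | h1 <;> rcases le_total r s with h2 | h2
    · rcases le_total p r with h | h
      · exact ⟨p, by grind⟩
      · exact ⟨r, by grind⟩
    · rcases le_total p s with h | h
      · exact ⟨p, by grind⟩
      · exact ⟨s, by grind⟩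
    · rcases le_total q r with h | h
      · exact ⟨q, by grind⟩
      · exact ⟨r, by grind⟩
    · rcases le_total q s with h | h
      · exact ⟨q, by grind⟩
      · exact ⟨s, by grind⟩
  simp only [region, Set.mem_ofPred_eq] at hr ⊢
  obtain ⟨hx0, hy0, hz0, h1, h2, h3, h4, h5, h6, h7⟩ := hr
  obtain ⟨x', hx, ha1, ha2, ha3, ha4, hxt⟩ :=
    raise F.a (F.ab - y) (F.ac - z) (F.abc - y - z) x (by linarith) (by linarith) (by linarith)
      (by linarith)
  obtain ⟨y', hy, hb1, hb2, hb3, hb4, hyt⟩ :=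
    raise F.b (F.ab - x') (F.bc - z) (F.abc - x' - z) y (by linarith) (by linarith) (by linarith)
      (by linarith)
  obtain ⟨z', hz, hc1, hc2, hc3, hc4, hzt⟩ :=
    raise F.c (F.ac - x') (F.bc - y') (F.abc - x' - y') z (by linarith) (by linarith)
      (by linarith) (by linarith)
  refine ⟨(x', y', z'), ⟨by linarith, by linarith, by linarith, by linarith, by linarith,
    by linarith, by linarith, by linarith, by linarith, by linarith⟩, ⟨hx, hy, hz⟩, ?_⟩
  refine le_antisymm (by linarith) ?_
  cases F
  simp only at *
  rcases hxt with h | h | h | h <;> rcases hyt with h' | h' | h' | h' <;>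
    rcases hzt with h'' | h'' | h'' | h'' <;> linarith

end Polymatroid3

theorem exists_mem_Icc_mul_eq {x d : ℝ} (hx : 0 ≤ x) (hxd : x ≤ d) :
    ∃ t ∈ Set.Icc (0 : ℝ) 1, x = t * d := by
  rcases (hx.trans hxd).eq_or_lt with h | h
  · exact ⟨0, by simp, by linarith⟩
  · exact ⟨x / d, ⟨by positivity, (div_le_one h).2 hxd⟩, by field_simp⟩

namespace Polymatroid3

variable (F : Polymatroid3)

/-- The part of the dominant face beyond the segment from `vBAC` to `vACB` lies in the triangle
with vertices `vACB`, `vABC`, `vBAC`. -/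
theorem exists_triangle {s : ℝ × ℝ × ℝ} (hs : s ∈ F.region)
    (hsum : s.1 + s.2.1 + s.2.2 = F.abc) {t : ℝ} (ht : t ∈ Set.Icc (0 : ℝ) 1)
    (hst : s.2.1 - (F.abc - F.ac) = t * (F.b - (F.abc - F.ac)))
    (hlt : s.1 < (1 - t) * (F.ac - F.c) + t * (F.abc - F.bc)) :
    ∃ α ∈ Set.Icc (0 : ℝ) 1, ∃ β ∈ Set.Icc (0 : ℝ) 1,
      s = ((1 - α) * (1 - β)) • F.vABC + (α * (1 - β)) • F.vBAC + β • F.vACB := by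
  obtain ⟨x, y, z⟩ := s
  obtain ⟨ht0, ht1⟩ := ht
  simp only [region, Set.mem_ofPred_eq] at hs hsum hst hlt
  obtain ⟨hx0, hy0, hz0, h1, h2, h3, h4, h5, h6, h7⟩ := hs
  have hd : 0 ≤ F.ac - F.c - (F.abc - F.bc) := by linarith [F.abc_add_c_le]
  have he : 0 ≤ F.c + F.b - F.bc := by linarith [F.bc_le]
  have htd : 0 ≤ t * (F.ac - F.c - (F.abc - F.bc)) := mul_nonneg ht0 hd
  -- `z` lies within `t` times the length of the leg of the triangle along the third axis
  have hz : F.c - z ≤ t * (F.c + F.b - F.bc) := by linarith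
  obtain ⟨u, ⟨hu0, hu1⟩, hu⟩ := exists_mem_Icc_mul_eq (by linarith : 0 ≤ F.c - z) hz
  have hβ1 : u * t ≤ t := mul_le_of_le_one_left ht0 hu1
  have hα : x - (F.abc - F.bc) ≤ (1 - u * t) * (F.ac - F.c - (F.abc - F.bc)) := by
    nlinarith
  obtain ⟨α, hα, hαx⟩ := exists_mem_Icc_mul_eq (by linarith : 0 ≤ x - (F.abc - F.bc)) hα
  refine ⟨α, hα, u * t, ⟨by positivity, by linarith⟩, ?_⟩
  simp only [vABC, vBAC, vACB, Prod.smul_mk, Prod.mk_add_mk, smul_eq_mul, Prod.mk.injEq]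
  refine ⟨?_, ?_, ?_⟩
  · linear_combination hαx
  · linear_combination hsum - hαx + hu
  · linear_combination -hu

/-- The trapezoid with vertices `vACB`, `vBAC`, `vBCA`, `vCAB`. -/
def trapezoid : Set (ℝ × ℝ × ℝ) :=
  {s | s.1 + s.2.1 + s.2.2 = F.abc ∧ ∃ t ∈ Set.Icc (0 : ℝ) 1,
    s.2.1 - (F.abc - F.ac) = t * (F.b - (F.abc - F.ac)) ∧
    (1 - t) * (F.ac - F.c) + t * (F.abc - F.bc) ≤ s.1 ∧
    s.1 ≤ (1 - t) * F.a + t * (F.ab - F.b)}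

theorem convex_trapezoid : Convex ℝ F.trapezoid := by
  rintro ⟨x, y, z⟩ ⟨h1, t, ht, h2, h3, h4⟩ ⟨x', y', z'⟩ ⟨h1', t', ht', h2', h3', h4'⟩ u v hu hv huv
  obtain rfl : v = 1 - u := by linarith
  simp only at *
  refine ⟨?_, u * t + (1 - u) * t', ?_, ?_, ?_, ?_⟩
  · simp only [Prod.smul_mk, Prod.mk_add_mk, smul_eq_mul]
    linear_combination u * h1 + (1 - u) * h1'
  · exact convex_Icc (0 : ℝ) 1 ht ht' hu hv huv
  · simp only [Prod.smul_mk, Prod.mk_add_mk, smul_eq_mul]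
    linear_combination u * h2 + (1 - u) * h2'
  · simp only [Prod.smul_mk, Prod.mk_add_mk, smul_eq_mul]
    linarith [mul_le_mul_of_nonneg_left h3 hu, mul_le_mul_of_nonneg_left h3' hv]
  · simp only [Prod.smul_mk, Prod.mk_add_mk, smul_eq_mul]
    linarith [mul_le_mul_of_nonneg_left h4 hu, mul_le_mul_of_nonneg_left h4' hv]

theorem convexHull_subset_trapezoid :
    convexHull ℝ {F.vACB, F.vBAC, F.vBCA, F.vCAB} ⊆ F.trapezoid := by
  refine convexHull_min ?_ F.convex_trapezoid
  rintro s (rfl | rfl | rfl | rfl)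
  · refine ⟨?_, 1, by simp, ?_, ?_, ?_⟩ <;> simp only [vACB] <;>
      linarith [F.abc_add_b_le]
  · refine ⟨?_, 0, by simp, ?_, ?_, ?_⟩ <;> simp only [vBAC] <;> linarith [F.ac_le]
  · refine ⟨?_, 0, by simp, ?_, ?_, ?_⟩ <;> simp only [vBCA] <;> linarith [F.ac_le]
  · refine ⟨?_, 1, by simp, ?_, ?_, ?_⟩ <;> simp only [vCAB] <;>
      linarith [F.abc_add_b_le]

theorem exists_of_mem_trapezoid {s : ℝ × ℝ × ℝ} (hs : s ∈ F.trapezoid) :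
    ∃ α ∈ Set.Icc (0 : ℝ) 1, ∃ β ∈ Set.Icc (0 : ℝ) 1,
      s = ((1 - α) * (1 - β)) • F.vBAC + ((1 - α) * β) • F.vACB + (α * (1 - β)) • F.vBCA
        + (α * β) • F.vCAB := by
  obtain ⟨x, y, z⟩ := s
  obtain ⟨hsum, β, hβ, hy, h1, h2⟩ := hs
  simp only at hsum hy h1 h2
  obtain ⟨α, hα, h⟩ := exists_mem_Icc_mul_eq (sub_nonneg.2 h1) (sub_le_sub_right h2 _)
  refine ⟨α, hα, β, hβ, ?_⟩
  simp only [vBAC, vACB, vBCA, vCAB, Prod.smul_mk, Prod.mk_add_mk, smul_eq_mul, Prod.mk.injEq]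
  refine ⟨?_, ?_, ?_⟩
  · linear_combination h
  · linear_combination hy
  · linear_combination hsum - h - hy

/-- The two triangles and the trapezoid cover the dominant face. -/
theorem exists_of_mem_dominant_face {s : ℝ × ℝ × ℝ} (hs : s ∈ F.region)
    (hsum : s.1 + s.2.1 + s.2.2 = F.abc) :
    ∃ α ∈ Set.Icc (0 : ℝ) 1, ∃ β ∈ Set.Icc (0 : ℝ) 1,
      s = ((1 - α) * (1 - β)) • F.vABC + (α * (1 - β)) • F.vBAC + β • F.vACB ∨
      s = ((1 - α) * β) • F.vCAB + (α * β) • F.vCBA + (1 - β) • F.vBCA ∨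
      s = ((1 - α) * (1 - β)) • F.vBAC + ((1 - α) * β) • F.vACB + (α * (1 - β)) • F.vBCA
        + (α * β) • F.vCAB := by
  have hs' := hs
  simp only [region, Set.mem_ofPred_eq] at hs'
  obtain ⟨hx0, hy0, hz0, h1, h2, h3, h4, h5, h6, h7⟩ := hs'
  obtain ⟨t, ht, hst⟩ := exists_mem_Icc_mul_eq
    (by linarith : 0 ≤ s.2.1 - (F.abc - F.ac)) (sub_le_sub_right h2 _)
  rcases lt_or_ge s.1 ((1 - t) * (F.ac - F.c) + t * (F.abc - F.bc)) with hA | hA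
  · obtain ⟨α, hα, β, hβ, h⟩ := F.exists_triangle hs hsum ht hst hA
    exact ⟨α, hα, β, hβ, Or.inl h⟩
  rcases lt_or_ge s.2.2 ((1 - t) * (F.ac - F.a) + t * (F.abc - F.ab)) with hC | hC
  · obtain ⟨α, ⟨hα0, hα1⟩, β, ⟨hβ0, hβ1⟩, h⟩ := F.swap.exists_triangle
      (s := (s.2.2, s.2.1, s.1)) ⟨hz0, hy0, hx0, h3, h2, h1, by simp only [swap]; linarith,
        by simp only [swap]; linarith, by simp only [swap]; linarith,
        by simp only [swap]; linarith⟩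
      (by simp only [swap]; linarith) ht hst hC
    simp only [vABC, vBAC, vACB, swap, Prod.smul_mk, Prod.mk_add_mk, smul_eq_mul,
      Prod.mk.injEq] at h
    obtain ⟨hz, hy, hx⟩ := h
    -- the erasure parametrization of the second triangle singles out a different vertex
    obtain ⟨α', hα', h'⟩ := exists_mem_Icc_mul_eq
      (x := (1 - α) * (1 - β)) (d := 1 - α * (1 - β))
      (mul_nonneg (by linarith) (by linarith)) (by linarith)
    have hnn : 0 ≤ α * (1 - β) := mul_nonneg hα0 (by linarith)
    have hle : α * (1 - β) ≤ 1 := mul_le_one₀ hα1 (by linarith) (by linarith)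
    refine ⟨α', hα', 1 - α * (1 - β), ⟨by linarith, by linarith⟩, Or.inr (Or.inl ?_)⟩
    obtain ⟨x, y, z⟩ := s
    simp only at hx hy hz
    simp only [vCAB, vCBA, vBCA, Prod.smul_mk, Prod.mk_add_mk, smul_eq_mul, Prod.mk.injEq]
    refine ⟨?_, ?_, ?_⟩
    · linear_combination hx + (F.a - (F.ab - F.b)) * h'
    · linear_combination hy + (F.ab - F.a - F.b) * h'
    · linear_combination hz
  · obtain ⟨α, hα, β, hβ, h⟩ := F.exists_of_mem_trapezoid
      (s := s) ⟨hsum, t, ht, hst, hA, by linarith⟩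
    exact ⟨α, hα, β, hβ, Or.inr (Or.inr h)⟩

theorem triangle_ABC_mem {α β : ℝ} (hα : α ∈ Set.Icc (0 : ℝ) 1) (hβ : β ∈ Set.Icc (0 : ℝ) 1) :
    ((1 - α) * (1 - β)) • F.vABC + (α * (1 - β)) • F.vBAC + β • F.vACB ∈ F.region := by
  have h := F.convex_region (F.convex_region F.vABC_mem F.vBAC_mem (sub_nonneg.2 hα.2) hα.1
    (sub_add_cancel 1 α)) F.vACB_mem (sub_nonneg.2 hβ.2) hβ.1 (sub_add_cancel 1 β)
  convert h using 1
  module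

theorem triangle_CBA_mem {α β : ℝ} (hα : α ∈ Set.Icc (0 : ℝ) 1) (hβ : β ∈ Set.Icc (0 : ℝ) 1) :
    ((1 - α) * β) • F.vCAB + (α * β) • F.vCBA + (1 - β) • F.vBCA ∈ F.region := by
  have h := F.convex_region (F.convex_region F.vCAB_mem F.vCBA_mem (sub_nonneg.2 hα.2) hα.1
    (sub_add_cancel 1 α)) F.vBCA_mem hβ.1 (sub_nonneg.2 hβ.2) (add_sub_cancel β 1)
  convert h using 1
  module

theorem trapezoid_mem {α β : ℝ} (hα : α ∈ Set.Icc (0 : ℝ) 1) (hβ : β ∈ Set.Icc (0 : ℝ) 1) :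
    ((1 - α) * (1 - β)) • F.vBAC + ((1 - α) * β) • F.vACB + (α * (1 - β)) • F.vBCA
      + (α * β) • F.vCAB ∈ F.region := by
  have h := F.convex_region
    (F.convex_region F.vBAC_mem F.vACB_mem (sub_nonneg.2 hβ.2) hβ.1 (sub_add_cancel 1 β))
    (F.convex_region F.vBCA_mem F.vCAB_mem (sub_nonneg.2 hβ.2) hβ.1 (sub_add_cancel 1 β))
    (sub_nonneg.2 hα.2) hα.1 (sub_add_cancel 1 α)
  convert h using 1
  module

theorem nonneg_of_mem_region {r : ℝ × ℝ × ℝ} (hr : r ∈ F.region) : 0 ≤ r :=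
  ⟨hr.1, hr.2.1, hr.2.2.1⟩

end Polymatroid3

theorem exists_of_mem_convexHull_triple {E : Type*} [AddCommGroup E] [Module ℝ E] {p q r x : E}
    (hx : x ∈ convexHull ℝ {p, q, r}) :
    ∃ α ∈ Set.Icc (0 : ℝ) 1, ∃ β ∈ Set.Icc (0 : ℝ) 1,
      x = ((1 - α) * β) • q + (α * β) • r + (1 - β) • p := by
  rw [convexHull_insert (Set.insert_nonempty _ _), convexHull_pair, mem_convexJoin] at hx
  obtain ⟨_, rfl, y, ⟨u, α, hu, hα, huα, rfl⟩, v, β, hv, hβ, hvβ, rfl⟩ := hx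
  refine ⟨α, ⟨hα, by linarith⟩, β, ⟨hβ, by linarith⟩, ?_⟩
  obtain rfl : u = 1 - α := by linarith
  obtain rfl : v = 1 - β := by linarith
  module

theorem cmiOf_eq {Ω β₁ β₂ β₃ τ υ ν ζ : Type*} [Fintype Ω] [Fintype β₁] [Fintype β₂] [Fintype β₃]
    [Fintype τ] [Fintype υ] [Fintype ν] [Fintype ζ] (q : Ω → ℝ) {X : Ω → β₁} {W : Ω → β₂}
    {Z : Ω → β₃} {T : Ω → τ} {U : Ω → υ} {V : Ω → ν} {Z' : Ω → ζ}
    (hT : ∀ ω ω', (X ω, Z ω) = (X ω', Z ω') ↔ T ω = T ω')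
    (hU : ∀ ω ω', (W ω, Z ω) = (W ω', Z ω') ↔ U ω = U ω')
    (hV : ∀ ω ω', (X ω, W ω, Z ω) = (X ω', W ω', Z ω') ↔ V ω = V ω')
    (hZ : ∀ ω ω', Z ω = Z ω' ↔ Z' ω = Z' ω') :
    cmiOf q X W Z = Hof q T + Hof q U - Hof q V - Hof q Z' := by
  rw [cmiOf, Hof_congr q hT, Hof_congr q hU, Hof_congr q hV, Hof_congr q hZ]

set_option maxHeartbeats 1000000 in
/-- The rank function `S ↦ I(X_S; Y | X_{Sᶜ})` of three independent random variables `A`, `B`, `C`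
is a polymatroid, and it determines all mutual informations with `Y`. -/
theorem exists_polymatroid_of_indep {Ω α β γ δ : Type*} [Fintype Ω] [Fintype α] [Fintype β]
    [Fintype γ] [Fintype δ] {q : Ω → ℝ} (hq : IsPMF q) (A : Ω → α) (B : Ω → β) (C : Ω → γ)
    (Y : Ω → δ)
    (hind : Hof q (fun ω => (A ω, B ω, C ω)) = Hof q A + Hof q B + Hof q C) :
    ∃ F : Polymatroid3,
      cmiOf q A Y (fun ω => (B ω, C ω)) = F.a ∧
      cmiOf q B Y (fun ω => (A ω, C ω)) = F.b ∧
      cmiOf q C Y (fun ω => (A ω, B ω)) = F.c ∧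
      cmiOf q (fun ω => (A ω, B ω)) Y C = F.ab ∧
      cmiOf q (fun ω => (A ω, C ω)) Y B = F.ac ∧
      cmiOf q (fun ω => (B ω, C ω)) Y A = F.bc ∧
      cmiOf q B Y A = F.bc - F.c ∧
      cmiOf q A Y B = F.ac - F.c ∧
      cmiOf q C Y B = F.ac - F.a ∧
      cmiOf q B Y C = F.ab - F.a ∧
      cmiOf q A Y C = F.ab - F.b ∧
      cmiOf q C Y A = F.bc - F.b ∧
      cmiOf q C Y (fun ω => (B ω, A ω)) = F.c ∧
      cmiOf q A Y (fun ω => (C ω, B ω)) = F.a ∧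
      cmiOf q B Y (fun ω => (C ω, A ω)) = F.b ∧
      miOf q A Y = F.abc - F.bc ∧
      miOf q B Y = F.abc - F.ac ∧
      miOf q C Y = F.abc - F.ab ∧
      miOf q (fun ω => (A ω, B ω, C ω)) Y = F.abc := by
  have hAB : Hof q (fun ω => (A ω, B ω)) = Hof q A + Hof q B := by
    have hABC : Hof q (fun ω => ((A ω, B ω), C ω)) = Hof q (fun ω => (A ω, B ω, C ω)) :=
      Hof_congr q (by grind)
    linarith [Hof_pair_le hq A B, Hof_pair_le hq (fun ω => (A ω, B ω)) C]
  have hAC : Hof q (fun ω => (A ω, C ω)) = Hof q A + Hof q C := by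
    have hACB : Hof q (fun ω => ((A ω, C ω), B ω)) = Hof q (fun ω => (A ω, B ω, C ω)) :=
      Hof_congr q (by grind)
    linarith [Hof_pair_le hq A C, Hof_pair_le hq (fun ω => (A ω, C ω)) B]
  have hBC : Hof q (fun ω => (B ω, C ω)) = Hof q B + Hof q C := by
    linarith [Hof_pair_le hq B C, Hof_pair_le hq A (fun ω => (B ω, C ω))]
  have hBAY : Hof q (fun ω => (B ω, A ω, Y ω))
      = Hof q (fun ω => (A ω, B ω, Y ω)) := Hof_congr q (by grind)
  have hCAY : Hof q (fun ω => (C ω, A ω, Y ω))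
      = Hof q (fun ω => (A ω, C ω, Y ω)) := Hof_congr q (by grind)
  have hCBY : Hof q (fun ω => (C ω, B ω, Y ω))
      = Hof q (fun ω => (B ω, C ω, Y ω)) := Hof_congr q (by grind)
  have hACBY : Hof q (fun ω => (A ω, C ω, B ω, Y ω))
      = Hof q (fun ω => (A ω, B ω, C ω, Y ω)) := Hof_congr q (by grind)
  have hBACY : Hof q (fun ω => (B ω, A ω, C ω, Y ω))
      = Hof q (fun ω => (A ω, B ω, C ω, Y ω)) := Hof_congr q (by grind)
  have hBCAY : Hof q (fun ω => (B ω, C ω, A ω, Y ω))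
      = Hof q (fun ω => (A ω, B ω, C ω, Y ω)) := Hof_congr q (by grind)
  have hCABY : Hof q (fun ω => (C ω, A ω, B ω, Y ω))
      = Hof q (fun ω => (A ω, B ω, C ω, Y ω)) := Hof_congr q (by grind)
  have sABY := cmiOf_nonneg hq.1 A B Y
  have sACY := cmiOf_nonneg hq.1 A C Y
  have sBCY := cmiOf_nonneg hq.1 B C Y
  have sABCY := cmiOf_nonneg hq.1 A B (fun ω => (C ω, Y ω))
  have sACBY := cmiOf_nonneg hq.1 A C (fun ω => (B ω, Y ω))
  have sBCAY := cmiOf_nonneg hq.1 B C (fun ω => (A ω, Y ω))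
  simp only [cmiOf, hBAY, hCAY, hCBY, hACBY, hBCAY] at sABY sACY sBCY sABCY sACBY sBCAY
  refine ⟨
    { a := Hof q A + Hof q (fun ω => (B ω, C ω, Y ω)) - Hof q (fun ω => (A ω, B ω, C ω, Y ω))
      b := Hof q B + Hof q (fun ω => (A ω, C ω, Y ω)) - Hof q (fun ω => (A ω, B ω, C ω, Y ω))
      c := Hof q C + Hof q (fun ω => (A ω, B ω, Y ω)) - Hof q (fun ω => (A ω, B ω, C ω, Y ω))
      ab := Hof q A + Hof q B + Hof q (fun ω => (C ω, Y ω)) - Hof q (fun ω => (A ω, B ω, C ω, Y ω))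
      ac := Hof q A + Hof q C + Hof q (fun ω => (B ω, Y ω)) - Hof q (fun ω => (A ω, B ω, C ω, Y ω))
      bc := Hof q B + Hof q C + Hof q (fun ω => (A ω, Y ω)) - Hof q (fun ω => (A ω, B ω, C ω, Y ω))
      abc := Hof q A + Hof q B + Hof q C + Hof q Y - Hof q (fun ω => (A ω, B ω, C ω, Y ω))
      a_nonneg := by linarith [Hof_pair_le hq A (fun ω => (B ω, C ω, Y ω))]
      b_nonneg := by linarith [Hof_pair_le hq B (fun ω => (A ω, C ω, Y ω))]
      c_nonneg := by linarith [Hof_pair_le hq C (fun ω => (A ω, B ω, Y ω))]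
      ab_le_abc := by linarith [Hof_pair_le hq C Y]
      ac_le_abc := by linarith [Hof_pair_le hq B Y]
      bc_le_abc := by linarith [Hof_pair_le hq A Y]
      a_le_ab := by linarith [Hof_pair_le hq B (fun ω => (C ω, Y ω))]
      b_le_ab := by linarith [Hof_pair_le hq A (fun ω => (C ω, Y ω))]
      a_le_ac := by linarith [Hof_pair_le hq C (fun ω => (B ω, Y ω))]
      c_le_ac := by linarith [Hof_pair_le hq A (fun ω => (B ω, Y ω))]
      b_le_bc := by linarith [Hof_pair_le hq C (fun ω => (A ω, Y ω))]
      c_le_bc := by linarith [Hof_pair_le hq B (fun ω => (A ω, Y ω))]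
      ab_le := by linarith
      ac_le := by linarith
      bc_le := by linarith
      abc_add_a_le := by linarith
      abc_add_b_le := by linarith
      abc_add_c_le := by linarith },
    ?_, ?_, ?_, ?_, ?_, ?_, ?_, ?_, ?_, ?_, ?_, ?_, ?_, ?_, ?_, ?_, ?_, ?_, ?_⟩
  · rw [cmiOf_eq (T := (fun ω => (A ω, B ω, C ω))) (U := (fun ω => (B ω, C ω, Y ω)))
      (V := (fun ω => (A ω, B ω, C ω, Y ω))) (Z' := (fun ω => (B ω, C ω))) q
      (by grind) (by grind) (by grind) (by grind)]
    linarith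
  · rw [cmiOf_eq (T := (fun ω => (A ω, B ω, C ω))) (U := (fun ω => (A ω, C ω, Y ω)))
      (V := (fun ω => (A ω, B ω, C ω, Y ω))) (Z' := (fun ω => (A ω, C ω))) q
      (by grind) (by grind) (by grind) (by grind)]
    linarith
  · rw [cmiOf_eq (T := (fun ω => (A ω, B ω, C ω))) (U := (fun ω => (A ω, B ω, Y ω)))
      (V := (fun ω => (A ω, B ω, C ω, Y ω))) (Z' := (fun ω => (A ω, B ω))) q
      (by grind) (by grind) (by grind) (by grind)]
    linarith
  · rw [cmiOf_eq (T := (fun ω => (A ω, B ω, C ω))) (U := (fun ω => (C ω, Y ω)))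
      (V := (fun ω => (A ω, B ω, C ω, Y ω))) (Z' := C) q
      (by grind) (by grind) (by grind) (by grind)]
    linarith
  · rw [cmiOf_eq (T := (fun ω => (A ω, B ω, C ω))) (U := (fun ω => (B ω, Y ω)))
      (V := (fun ω => (A ω, B ω, C ω, Y ω))) (Z' := B) q
      (by grind) (by grind) (by grind) (by grind)]
    linarith
  · rw [cmiOf_eq (T := (fun ω => (A ω, B ω, C ω))) (U := (fun ω => (A ω, Y ω)))
      (V := (fun ω => (A ω, B ω, C ω, Y ω))) (Z' := A) q
      (by grind) (by grind) (by grind) (by grind)]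
    linarith
  · rw [cmiOf_eq (T := (fun ω => (A ω, B ω))) (U := (fun ω => (A ω, Y ω)))
      (V := (fun ω => (A ω, B ω, Y ω))) (Z' := A) q
      (by grind) (by grind) (by grind) (by grind)]
    linarith
  · rw [cmiOf_eq (T := (fun ω => (A ω, B ω))) (U := (fun ω => (B ω, Y ω)))
      (V := (fun ω => (A ω, B ω, Y ω))) (Z' := B) q
      (by grind) (by grind) (by grind) (by grind)]
    linarith
  · rw [cmiOf_eq (T := (fun ω => (B ω, C ω))) (U := (fun ω => (B ω, Y ω)))
      (V := (fun ω => (B ω, C ω, Y ω))) (Z' := B) q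
      (by grind) (by grind) (by grind) (by grind)]
    linarith
  · rw [cmiOf_eq (T := (fun ω => (B ω, C ω))) (U := (fun ω => (C ω, Y ω)))
      (V := (fun ω => (B ω, C ω, Y ω))) (Z' := C) q
      (by grind) (by grind) (by grind) (by grind)]
    linarith
  · rw [cmiOf_eq (T := (fun ω => (A ω, C ω))) (U := (fun ω => (C ω, Y ω)))
      (V := (fun ω => (A ω, C ω, Y ω))) (Z' := C) q
      (by grind) (by grind) (by grind) (by grind)]
    linarith
  · rw [cmiOf_eq (T := (fun ω => (A ω, C ω))) (U := (fun ω => (A ω, Y ω)))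
      (V := (fun ω => (A ω, C ω, Y ω))) (Z' := A) q
      (by grind) (by grind) (by grind) (by grind)]
    linarith
  · rw [cmiOf_eq (T := (fun ω => (A ω, B ω, C ω))) (U := (fun ω => (A ω, B ω, Y ω)))
      (V := (fun ω => (A ω, B ω, C ω, Y ω))) (Z' := (fun ω => (A ω, B ω))) q
      (by grind) (by grind) (by grind) (by grind)]
    linarith
  · rw [cmiOf_eq (T := (fun ω => (A ω, B ω, C ω))) (U := (fun ω => (B ω, C ω, Y ω)))
      (V := (fun ω => (A ω, B ω, C ω, Y ω))) (Z' := (fun ω => (B ω, C ω))) q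
      (by grind) (by grind) (by grind) (by grind)]
    linarith
  · rw [cmiOf_eq (T := (fun ω => (A ω, B ω, C ω))) (U := (fun ω => (A ω, C ω, Y ω)))
      (V := (fun ω => (A ω, B ω, C ω, Y ω))) (Z' := (fun ω => (A ω, C ω))) q
      (by grind) (by grind) (by grind) (by grind)]
    linarith
  · rw [miOf]
    linarith
  · rw [miOf]
    linarith
  · rw [miOf]
    linarith
  · have h : Hof q (fun ω => ((A ω, B ω, C ω), Y ω))
        = Hof q (fun ω => (A ω, B ω, C ω, Y ω)) := Hof_congr q (by grind)
    rw [miOf, h]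
    linarith

/-- The mutual informations `I(X_S; Y | X_{Sᶜ})` of a multiple-access channel with independent
inputs form a polymatroid, which determines the region and its corner points. -/
theorem exists_polymatroid_mac
    {pA : 𝒜 → ℝ} {pB : ℬ → ℝ} {pC : 𝒞 → ℝ} {ch : 𝒜 → ℬ → 𝒞 → 𝒴 → ℝ}
    (hpA : IsPMF pA) (hpB : IsPMF pB) (hpC : IsPMF pC)
    (hch0 : ∀ a b c y, 0 ≤ ch a b c y) (hch1 : ∀ a b c, ∑ y, ch a b c y = 1) :
    ∃ F : Polymatroid3, RMAC pA pB pC ch = F.region ∧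
      vABC pA pB pC ch = F.vABC ∧ vACB pA pB pC ch = F.vACB ∧ vBAC pA pB pC ch = F.vBAC ∧
      vBCA pA pB pC ch = F.vBCA ∧ vCBA pA pB pC ch = F.vCBA ∧ vCAB pA pB pC ch = F.vCAB := by
  obtain ⟨F, h1, h2, h3, h4, h5, h6, h7, h8, h9, h10, h11, h12, h13, h14, h15, h16, h17, h18, h19⟩ :=
    exists_polymatroid_of_indep (isPMF_macJoint hpA hpB hpC hch0 hch1) (fun ω => ω.1)
      (fun ω => ω.2.1) (fun ω => ω.2.2.1) (fun ω => ω.2.2.2) (Hof_inputs hpA hpB hpC hch1)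
  refine ⟨F, ?_, ?_, ?_, ?_, ?_, ?_, ?_⟩
  · simp only [RMAC, Polymatroid3.region, h1, h2, h3, h4, h5, h6, h19]
  · simp only [vABC, Polymatroid3.vABC, h16, h7, h3]
  · simp only [vACB, Polymatroid3.vACB, h16, h2, h12]
  · simp only [vBAC, Polymatroid3.vBAC, h8, h17, h13]
  · simp only [vBCA, Polymatroid3.vBCA, h1, h17, h9]
  · simp only [vCBA, Polymatroid3.vCBA, h14, h10, h18]
  · simp only [vCAB, Polymatroid3.vCAB, h11, h15, h18]

/-- Erasure version of the three-user layer-splitting lemma, together with the coverage of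
the two triangles and the trapezoid of the dominant face. -/
theorem mac_layer_splitting_erasure
    (pA : 𝒜 → ℝ) (pB : ℬ → ℝ) (pC : 𝒞 → ℝ) (ch : 𝒜 → ℬ → 𝒞 → 𝒴 → ℝ)
    (hpA : IsPMF pA) (hpB : IsPMF pB) (hpC : IsPMF pC)
    (hch0 : ∀ a b c y, 0 ≤ ch a b c y) (hch1 : ∀ a b c, ∑ y, ch a b c y = 1) :
    (RMAC pA pB pC ch
      = ⋃ (α ∈ Set.Icc (0:ℝ) 1) (β ∈ Set.Icc (0:ℝ) 1),
          (RegE1 pA pB pC ch α β ∪ RegE2 pA pB pC ch α β ∪ RegE3 pA pB pC ch α β)) ∧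
    (convexHull ℝ {vACB pA pB pC ch, vABC pA pB pC ch, vBAC pA pB pC ch}
      ⊆ ⋃ (α ∈ Set.Icc (0:ℝ) 1) (β ∈ Set.Icc (0:ℝ) 1), RegE1 pA pB pC ch α β) ∧
    (convexHull ℝ {vBCA pA pB pC ch, vCBA pA pB pC ch, vCAB pA pB pC ch}
      ⊆ ⋃ (α ∈ Set.Icc (0:ℝ) 1) (β ∈ Set.Icc (0:ℝ) 1), RegE2 pA pB pC ch α β) ∧
    (convexHull ℝ {vACB pA pB pC ch, vBAC pA pB pC ch, vBCA pA pB pC ch, vCAB pA pB pC ch}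
      ⊆ ⋃ (α ∈ Set.Icc (0:ℝ) 1) (β ∈ Set.Icc (0:ℝ) 1), RegE3 pA pB pC ch α β) := by
  obtain ⟨F, hR, hABC, hACB, hBAC, hBCA, hCBA, hCAB⟩ :=
    exists_polymatroid_mac hpA hpB hpC hch0 hch1
  simp only [RegE1, RegE2, RegE3, hR, hABC, hACB, hBAC, hBCA, hCBA, hCAB]
  refine ⟨?_, ?_, ?_, ?_⟩
  · ext r
    simp only [Set.mem_iUnion, Set.mem_union, Set.mem_ofPred_eq, exists_prop]
    constructor
    · intro hr
      obtain ⟨s, hs, hrs, hsum⟩ := F.exists_dominating hr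
      have hr0 := F.nonneg_of_mem_region hr
      obtain ⟨α, hα, β, hβ, h | h | h⟩ := F.exists_of_mem_dominant_face hs hsum
      · exact ⟨α, hα, β, hβ, Or.inl (Or.inl ⟨hr0, h ▸ hrs⟩)⟩
      · exact ⟨α, hα, β, hβ, Or.inl (Or.inr ⟨hr0, h ▸ hrs⟩)⟩
      · exact ⟨α, hα, β, hβ, Or.inr ⟨hr0, h ▸ hrs⟩⟩
    · rintro ⟨α, hα, β, hβ, (⟨h0, h⟩ | ⟨h0, h⟩) | ⟨h0, h⟩⟩
      · exact F.mem_region_of_le h0 h (F.triangle_ABC_mem hα hβ)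
      · exact F.mem_region_of_le h0 h (F.triangle_CBA_mem hα hβ)
      · exact F.mem_region_of_le h0 h (F.trapezoid_mem hα hβ)
  · intro r hr
    simp only [Set.mem_iUnion, Set.mem_ofPred_eq, exists_prop]
    obtain ⟨α, hα, β, hβ, rfl⟩ := exists_of_mem_convexHull_triple hr
    have hβ' : 1 - β ∈ Set.Icc (0 : ℝ) 1 := Set.Icc.mem_iff_one_sub_mem.1 hβ
    have h := F.nonneg_of_mem_region (F.triangle_ABC_mem hα hβ')
    rw [sub_sub_cancel] at h
    exact ⟨α, hα, 1 - β, hβ', h, by rw [sub_sub_cancel]⟩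
  · intro r hr
    simp only [Set.mem_iUnion, Set.mem_ofPred_eq, exists_prop]
    rw [Set.pair_comm] at hr
    obtain ⟨α, hα, β, hβ, rfl⟩ := exists_of_mem_convexHull_triple hr
    exact ⟨α, hα, β, hβ, F.nonneg_of_mem_region (F.triangle_CBA_mem hα hβ), le_rfl⟩
  · intro r hr
    simp only [Set.mem_iUnion, Set.mem_ofPred_eq, exists_prop]
    obtain ⟨α, hα, β, hβ, rfl⟩ := F.exists_of_mem_trapezoid (F.convexHull_subset_trapezoid hr)
    exact ⟨α, hα, β, hβ, F.nonneg_of_mem_region (F.trapezoid_mem hα hβ), le_rfl⟩
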